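/- If nonnegative functions (F_Q)_{Q∈𝒢} (𝒢 countable) satisfy ‖F_Q‖_{L^p(ν)}^p ≤ K^p·(⨍_Q f dμ)^p·μ(Q) for each Q, and the family (μ(Q))_{Q∈𝒢} satisfies the Carleson condition ∑_{Q∈𝒢, Q⊆R} μ(Q) ≤ Λ·μ(R) for all R in the lattice, then ‖(∑_{Q∈𝒢} F_Q^p)^{1/p}‖_{L^p(ν)} ≤ K·Λ^{1/p}·p'·‖f‖_{L^p(μ)}. -/

import Mathlib

open MeasureTheory ENNReal Set

/-- The dyadic cube of generation `k` at position `m` in `ℝⁿ`. -/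
def dyadicCube (n : ℕ) (k : ℤ) (m : Fin n → ℤ) : Set (Fin n → ℝ) :=
  {x | ∀ i, (m i : ℝ) * (2 : ℝ) ^ (-k) ≤ x i ∧ x i < ((m i : ℝ) + 1) * (2 : ℝ) ^ (-k)}

/-- The average `⨍_Q f dμ`, interpreted as `0` when `μ Q = 0` or `μ Q = ∞`. -/
noncomputable def dyAvg {X : Type*} [MeasurableSpace X] (μ : Measure X)
    (f : X → ℝ≥0∞) (Q : Set X) : ℝ≥0∞ :=
  if μ Q = 0 then 0 else (∫⁻ x in Q, f x ∂μ) / μ Q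

open Filter in
/-- The layer cake formula for powers of finite `ℝ≥0∞`-valued functions. -/
theorem lintegral_rpow_eq_lintegral_meas_ofReal_lt {α : Type*} [MeasurableSpace α]
    (μ : Measure α) {g : α → ℝ≥0∞} (hg : Measurable g) (hfin : ∀ x, g x ≠ ∞)
    {p : ℝ} (hp : 0 < p) :
    ∫⁻ x, g x ^ p ∂μ = ENNReal.ofReal p *
      ∫⁻ t in Ioi (0 : ℝ), μ {x | ENNReal.ofReal t < g x} * ENNReal.ofReal (t ^ (p - 1)) := by
  have h := lintegral_rpow_eq_lintegral_meas_lt_mul μ (f := fun x => (g x).toReal)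
    (Eventually.of_forall fun x => ENNReal.toReal_nonneg) hg.ennreal_toReal.aemeasurable hp
  have hpow : ∀ x, ENNReal.ofReal ((g x).toReal ^ p) = g x ^ p := fun x => by
    rw [← ENNReal.ofReal_rpow_of_nonneg ENNReal.toReal_nonneg hp.le, ENNReal.ofReal_toReal (hfin x)]
  simp only [hpow] at h
  rw [h]
  congr 1
  refine setLIntegral_congr_fun measurableSet_Ioi fun t ht => ?_
  have hset : {x | t < (g x).toReal} = {x | ENNReal.ofReal t < g x} := by
    ext x
    exact (ENNReal.ofReal_lt_iff_lt_toReal (le_of_lt ht) (hfin x)).symm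
  simp only [hset]

/-- A comparison of distribution functions gives a comparison of `L^p` norms. -/
theorem lintegral_rpow_le_of_meas_lt_le {α β : Type*} [MeasurableSpace α] [MeasurableSpace β]
    (κ : Measure β) (μ : Measure α) {a : β → ℝ≥0∞} {g : α → ℝ≥0∞} (ha : Measurable a)
    (hg : Measurable g) (hafin : ∀ x, a x ≠ ∞) (hgfin : ∀ x, g x ≠ ∞) {p : ℝ} (hp : 0 < p)
    (C : ℝ≥0∞)
    (h : ∀ t : ℝ, 0 < t → κ {x | ENNReal.ofReal t < a x} ≤ C * μ {x | ENNReal.ofReal t < g x}) :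
    ∫⁻ x, a x ^ p ∂κ ≤ C * ∫⁻ x, g x ^ p ∂μ := by
  rw [lintegral_rpow_eq_lintegral_meas_ofReal_lt κ ha hafin hp,
    lintegral_rpow_eq_lintegral_meas_ofReal_lt μ hg hgfin hp, mul_left_comm]
  have hmeas : Measurable fun t : ℝ => μ {x | ENNReal.ofReal t < g x} := by
    refine Antitone.measurable fun s t hst => measure_mono fun x hx => ?_
    exact (ENNReal.ofReal_le_ofReal hst).trans_lt hx
  have hweight : Measurable fun t : ℝ => ENNReal.ofReal (t ^ (p - 1)) := by fun_prop
  have hprod : Measurable fun t : ℝ =>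
      μ {x | ENNReal.ofReal t < g x} * ENNReal.ofReal (t ^ (p - 1)) := hmeas.mul hweight
  rw [← lintegral_const_mul C hprod]
  gcongr ENNReal.ofReal p * ?_
  refine setLIntegral_mono' measurableSet_Ioi fun t ht => ?_
  rw [← mul_assoc]
  gcongr
  exact h t ht

/-- Doob's `L^p` inequality, deduced from the weak type bound `t μ(g > t) ≤ ∫_{g > t} f dμ`. -/
theorem lintegral_rpow_le_of_weak_type {α : Type*} [MeasurableSpace α] (μ : Measure α)
    {f g : α → ℝ≥0∞} (hf : Measurable f) (hg : Measurable g) (hgfin : ∀ x, g x ≠ ∞)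
    {p : ℝ} (hp : 1 < p) (hgp : ∫⁻ x, g x ^ p ∂μ ≠ ∞)
    (h : ∀ t : ℝ, 0 < t → ENNReal.ofReal t * μ {x | ENNReal.ofReal t < g x} ≤
      ∫⁻ x in {x | ENNReal.ofReal t < g x}, f x ∂μ) :
    ∫⁻ x, g x ^ p ∂μ ≤ ENNReal.ofReal (p / (p - 1)) ^ p * ∫⁻ x, f x ^ p ∂μ := by
  have hp0 : 0 < p := by linarith
  have hp1 : 0 < p - 1 := by linarith
  have hmul : ∫⁻ x, g x ^ p ∂μ ≤
      ENNReal.ofReal (p / (p - 1)) * ∫⁻ x, f x * g x ^ (p - 1) ∂μ := by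
    have hwd := lintegral_rpow_eq_lintegral_meas_ofReal_lt (μ.withDensity f) hg hgfin hp1
    rw [lintegral_withDensity_eq_lintegral_mul _ hf (hg.pow_const _)] at hwd
    simp only [Pi.mul_apply] at hwd
    rw [hwd, lintegral_rpow_eq_lintegral_meas_ofReal_lt μ hg hgfin hp0, ← mul_assoc,
      ← ENNReal.ofReal_mul (by positivity), div_mul_cancel₀ _ hp1.ne']
    gcongr ENNReal.ofReal p * ?_
    refine setLIntegral_mono' measurableSet_Ioi fun t ht => ?_
    have ht0 : (0 : ℝ) < t := ht
    rw [withDensity_apply _ (measurableSet_lt measurable_const hg)]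
    have hpow : t ^ (p - 1) = t * t ^ (p - 1 - 1) := by
      rw [Real.rpow_sub_one ht0.ne' (p - 1)]
      field_simp
    rw [hpow, ENNReal.ofReal_mul ht0.le, ← mul_assoc, mul_comm (μ _)]
    gcongr
    exact h t ht0
  have hpq := Real.HolderConjugate.conjExponent hp
  have hholder := ENNReal.lintegral_mul_le_Lp_mul_Lq μ hpq hf.aemeasurable
    (hg.pow_const (p - 1)).aemeasurable
  have hq : ∀ x, (g x ^ (p - 1)) ^ p.conjExponent = g x ^ p := fun x => by
    rw [← ENNReal.rpow_mul, Real.conjExponent, mul_div_cancel₀ _ hp1.ne']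
  simp only [hq, Pi.mul_apply] at hholder
  set I := ∫⁻ x, g x ^ p ∂μ
  rcases eq_or_ne I 0 with hI | hI
  · simp [hI]
  have hmain : I ≤ (ENNReal.ofReal (p / (p - 1)) * (∫⁻ x, f x ^ p ∂μ) ^ (1 / p)) *
      I ^ (1 / p.conjExponent) := by
    rw [mul_assoc]
    exact hmul.trans (by gcongr)
  have hsplit : I = I ^ (1 / p) * I ^ (1 / p.conjExponent) := by
    rw [← ENNReal.rpow_add _ _ hI hgp, one_div, one_div, hpq.inv_add_inv_eq_one, ENNReal.rpow_one]
  have hroot : I ^ (1 / p) ≤ ENNReal.ofReal (p / (p - 1)) * (∫⁻ x, f x ^ p ∂μ) ^ (1 / p) := by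
    refine (ENNReal.mul_le_mul_iff_left (c := I ^ (1 / p.conjExponent)) ?_ ?_).1
      (hsplit.symm.trans_le hmain)
    · simp [ENNReal.rpow_eq_zero_iff, hI, hgp]
    · simp [ENNReal.rpow_eq_top_iff, hI, hgp]
  have hfinal := ENNReal.rpow_le_rpow hroot hp0.le
  rwa [ENNReal.mul_rpow_of_nonneg _ _ hp0.le, ← ENNReal.rpow_mul, ← ENNReal.rpow_mul,
    one_div_mul_cancel hp0.ne', ENNReal.rpow_one, ENNReal.rpow_one] at hfinal

/-- Every finite nested family of sets has a disjoint subfamily dominating all its members. -/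
theorem exists_pairwiseDisjoint_subset_of_nested {ι α : Type*} (Q : ι → Set α)
    (hQ : ∀ i j, Q i ⊆ Q j ∨ Q j ⊆ Q i ∨ Disjoint (Q i) (Q j)) (A : Finset ι) :
    ∃ R ⊆ A, (R : Set ι).PairwiseDisjoint Q ∧ ∀ i ∈ A, ∃ j ∈ R, Q i ⊆ Q j := by
  classical
  induction A using Finset.induction_on with
  | empty => exact ⟨∅, by simp⟩
  | insert a A _ ih =>
    obtain ⟨R, hRA, hdisj, hdom⟩ := ih
    by_cases ha : ∃ j ∈ R, Q a ⊆ Q j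
    · refine ⟨R, hRA.trans (Finset.subset_insert _ _), hdisj, fun i hi => ?_⟩
      rcases Finset.mem_insert.1 hi with rfl | hi
      exacts [ha, hdom i hi]
    · push Not at ha
      refine ⟨insert a (R.filter fun j => ¬ Q j ⊆ Q a),
        Finset.insert_subset_insert _ ((Finset.filter_subset _ _).trans hRA), ?_, fun i hi => ?_⟩
      · rw [Finset.coe_insert]
        refine Set.PairwiseDisjoint.insert
          (hdisj.subset (by exact_mod_cast Finset.filter_subset _ _)) fun j hj _ => ?_
        obtain ⟨hjR, hja⟩ := Finset.mem_filter.1 (Finset.mem_coe.1 hj)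
        rcases hQ a j with h | h | h
        exacts [absurd h (ha j hjR), absurd h hja, h]
      · rcases Finset.mem_insert.1 hi with rfl | hi
        · exact ⟨i, Finset.mem_insert_self _ _, Subset.rfl⟩
        obtain ⟨j, hjR, hij⟩ := hdom i hi
        by_cases hja : Q j ⊆ Q a
        · exact ⟨a, Finset.mem_insert_self _ _, hij.trans hja⟩
        · exact ⟨j, Finset.mem_insert_of_mem (Finset.mem_filter.2 ⟨hjR, hja⟩), hij⟩

theorem biUnion_eq_of_dominating {ι α : Type*} {Q : ι → Set α} {A R : Finset ι} (hRA : R ⊆ A)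
    (hdom : ∀ i ∈ A, ∃ j ∈ R, Q i ⊆ Q j) : ⋃ i ∈ A, Q i = ⋃ i ∈ R, Q i := by
  refine Subset.antisymm (iUnion₂_subset fun i hi => ?_) (biUnion_subset_biUnion_left hRA)
  obtain ⟨j, hj, hij⟩ := hdom i hi
  exact hij.trans (subset_biUnion_of_mem (u := Q) hj)

/-- The Carleson condition for single sets implies the one for unions of a nested family. -/
theorem sum_measure_le_mul_measure_biUnion {ι α : Type*} [MeasurableSpace α] (μ : Measure α)
    (Q : ι → Set α) (hmeas : ∀ i, MeasurableSet (Q i))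
    (hQ : ∀ i j, Q i ⊆ Q j ∨ Q j ⊆ Q i ∨ Disjoint (Q i) (Q j)) (A : Finset ι) (C : ℝ≥0∞)
    (hC : ∀ j, ∀ B ⊆ A, (∀ i ∈ B, Q i ⊆ Q j) → ∑ i ∈ B, μ (Q i) ≤ C * μ (Q j)) :
    ∑ i ∈ A, μ (Q i) ≤ C * μ (⋃ i ∈ A, Q i) := by
  classical
  obtain ⟨R, hRA, hdisj, hdom⟩ := exists_pairwiseDisjoint_subset_of_nested Q hQ A
  rw [biUnion_eq_of_dominating hRA hdom, measure_biUnion_finset hdisj fun i _ => hmeas i,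
    Finset.mul_sum]
  calc ∑ i ∈ A, μ (Q i)
      ≤ ∑ i ∈ A, ∑ j ∈ R, if Q i ⊆ Q j then μ (Q i) else 0 := by
        refine Finset.sum_le_sum fun i hi => ?_
        obtain ⟨j, hj, hij⟩ := hdom i hi
        refine le_trans (by simp [hij]) (Finset.single_le_sum
          (f := fun j => if Q i ⊆ Q j then μ (Q i) else 0) (fun _ _ => zero_le) hj)
    _ = ∑ j ∈ R, ∑ i ∈ A.filter fun i => Q i ⊆ Q j, μ (Q i) := by
        rw [Finset.sum_comm]
        simp only [Finset.sum_filter]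
    _ ≤ ∑ j ∈ R, C * μ (Q j) := by
        refine Finset.sum_le_sum fun j _ => hC j _ (Finset.filter_subset _ _) fun i hi => ?_
        exact (Finset.mem_filter.1 hi).2

theorem mul_measure_biUnion_le_lintegral {ι α : Type*} [MeasurableSpace α] (μ : Measure α)
    (Q : ι → Set α) (hmeas : ∀ i, MeasurableSet (Q i))
    (hQ : ∀ i j, Q i ⊆ Q j ∨ Q j ⊆ Q i ∨ Disjoint (Q i) (Q j)) (A : Finset ι)
    (f : α → ℝ≥0∞) (t : ℝ≥0∞) (ht : ∀ i ∈ A, t * μ (Q i) ≤ ∫⁻ x in Q i, f x ∂μ) :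
    t * μ (⋃ i ∈ A, Q i) ≤ ∫⁻ x in ⋃ i ∈ A, Q i, f x ∂μ := by
  obtain ⟨R, hRA, hdisj, hdom⟩ := exists_pairwiseDisjoint_subset_of_nested Q hQ A
  rw [biUnion_eq_of_dominating hRA hdom, measure_biUnion_finset hdisj fun i _ => hmeas i,
    Finset.mul_sum, lintegral_biUnion_finset hdisj fun i _ => hmeas i]
  exact Finset.sum_le_sum fun i hi => ht i (hRA hi)

theorem setLIntegral_ne_top_of_lintegral_rpow_ne_top {α : Type*} [MeasurableSpace α]
    (μ : Measure α) {f : α → ℝ≥0∞} {p : ℝ} (hp : 1 ≤ p) (hf : ∫⁻ x, f x ^ p ∂μ ≠ ∞)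
    {s : Set α} (hs : μ s ≠ ∞) : ∫⁻ x in s, f x ∂μ ≠ ∞ := by
  have hle : ∀ x, f x ≤ 1 + f x ^ p := fun x => by
    rcases le_total (f x) 1 with h | h
    · exact h.trans le_self_add
    · refine le_trans ?_ le_add_self
      simpa using ENNReal.rpow_le_rpow_of_exponent_le h hp
  refine ne_top_of_le_ne_top ?_ (lintegral_mono hle)
  rw [lintegral_add_left measurable_const, setLIntegral_one]
  exact ENNReal.add_ne_top.2 ⟨hs, ne_top_of_le_ne_top hf (setLIntegral_le_lintegral _ _)⟩

theorem dyAvg_ne_top {α : Type*} [MeasurableSpace α] {μ : Measure α} {f : α → ℝ≥0∞} {s : Set α}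
    (hf : ∫⁻ x in s, f x ∂μ ≠ ∞) : dyAvg μ f s ≠ ∞ := by
  unfold dyAvg
  split_ifs with h
  exacts [zero_ne_top, ENNReal.div_ne_top hf h]

theorem dyAvg_mul_measure_le {α : Type*} [MeasurableSpace α] (μ : Measure α) (f : α → ℝ≥0∞)
    (s : Set α) : dyAvg μ f s * μ s ≤ ∫⁻ x in s, f x ∂μ := by
  unfold dyAvg
  split_ifs with h
  exacts [by simp, by rw [mul_comm]; exact ENNReal.mul_div_le]

/-- The Martingale Carleson Embedding Theorem for a finite nested family of sets. -/
theorem sum_dyAvg_rpow_mul_measure_le {ι α : Type*} [MeasurableSpace α] (μ : Measure α)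
    (Q : ι → Set α) (hmeas : ∀ i, MeasurableSet (Q i)) (hfin : ∀ i, μ (Q i) ≠ ∞)
    (hQ : ∀ i j, Q i ⊆ Q j ∨ Q j ⊆ Q i ∨ Disjoint (Q i) (Q j)) (T : Finset ι) (C : ℝ≥0∞)
    (hC : ∀ j, ∀ B ⊆ T, (∀ i ∈ B, Q i ⊆ Q j) → ∑ i ∈ B, μ (Q i) ≤ C * μ (Q j))
    {p : ℝ} (hp : 1 < p) {f : α → ℝ≥0∞} (hf : Measurable f) (hfp : ∫⁻ x, f x ^ p ∂μ ≠ ∞) :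
    ∑ i ∈ T, dyAvg μ f (Q i) ^ p * μ (Q i) ≤
      C * (ENNReal.ofReal (p / (p - 1)) ^ p * ∫⁻ x, f x ^ p ∂μ) := by
  classical
  have hp0 : 0 < p := by linarith
  set a : ι → ℝ≥0∞ := fun i => dyAvg μ f (Q i)
  have ha : ∀ i, a i ≠ ∞ := fun i =>
    dyAvg_ne_top (setLIntegral_ne_top_of_lintegral_rpow_ne_top μ hp.le hfp (hfin i))
  set M : α → ℝ≥0∞ := fun x => T.sup fun i => (Q i).indicator (fun _ => a i) x with hM_def
  have hM : Measurable M := by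
    simp only [hM_def, Finset.sup_eq_iSup]
    exact .biSup _ T.countable_toSet fun i _ => measurable_const.indicator (hmeas i)
  have hMle : ∀ x, M x ≤ ∑ i ∈ T, (Q i).indicator (fun _ => a i) x := fun x =>
    Finset.sup_le fun i hi => Finset.single_le_sum (f := fun i => (Q i).indicator (fun _ => a i) x)
      (fun _ _ => zero_le) hi
  have hMfin : ∀ x, M x ≠ ∞ := fun x => by
    refine ne_top_of_le_ne_top (ENNReal.sum_ne_top.2 fun i _ => ?_) (hMle x)
    by_cases hx : x ∈ Q i <;> simp [hx, ha i]
  have hMp : ∫⁻ x, M x ^ p ∂μ ≠ ∞ := by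
    have hpow : ∀ x, M x ^ p ≤ ∑ i ∈ T, (Q i).indicator (fun _ => a i ^ p) x := fun x => by
      rw [hM_def]
      simp only
      rw [Finset.apply_sup_eq_sup_comp_of_linearOrder (fun y : ℝ≥0∞ => y ^ p)
        (ENNReal.monotone_rpow_of_nonneg hp0.le) (by simp [hp0])]
      refine Finset.sup_le fun i hi => le_trans (le_of_eq ?_) (Finset.single_le_sum
        (f := fun i => (Q i).indicator (fun _ => a i ^ p) x) (fun _ _ => zero_le) hi)
      by_cases hx : x ∈ Q i <;> simp [hx, hp0]
    refine ne_top_of_le_ne_top ?_ (lintegral_mono hpow)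
    rw [lintegral_finsetSum _ fun i _ => measurable_const.indicator (hmeas i)]
    refine ENNReal.sum_ne_top.2 fun i _ => ?_
    rw [lintegral_indicator_const (hmeas i)]
    exact ENNReal.mul_ne_top (ENNReal.rpow_ne_top_of_nonneg hp0.le (ha i)) (hfin i)
  have hMset : ∀ t : ℝ≥0∞, {x | t < M x} = ⋃ i ∈ T.filter fun i => t < a i, Q i := fun t => by
    ext x
    simp only [hM_def, mem_ofPred_eq, Finset.lt_sup_iff, mem_iUnion, Finset.mem_filter,
      exists_prop]
    refine exists_congr fun i => ?_
    by_cases hx : x ∈ Q i <;> simp [hx]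
  have hdoob := lintegral_rpow_le_of_weak_type μ hf hM hMfin hp hMp fun t _ => by
    rw [hMset]
    refine mul_measure_biUnion_le_lintegral μ Q hmeas hQ _ f _ fun i hi => ?_
    refine le_trans ?_ (dyAvg_mul_measure_le μ f (Q i))
    gcongr
    exact (Finset.mem_filter.1 hi).2.le
  let _ : MeasurableSpace ι := ⊤
  have hcarl := lintegral_rpow_le_of_meas_lt_le (∑ i ∈ T, μ (Q i) • Measure.dirac i) μ
    (a := a) measurable_from_top hM ha hMfin hp0 C fun t _ => by
      rw [hMset]
      refine le_trans (le_of_eq ?_) (sum_measure_le_mul_measure_biUnion μ Q hmeas hQ _ C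
        fun j B hB => hC j B (hB.trans (Finset.filter_subset _ _)))
      rw [Finset.sum_filter, Measure.finsetSum_apply]
      refine Finset.sum_congr rfl fun i _ => ?_
      simp [Measure.dirac_apply' i (MeasurableSpace.measurableSet_top), indicator_apply]
  rw [lintegral_finsetSum_measure] at hcarl
  simp only [lintegral_smul_measure, lintegral_dirac' _ measurable_from_top, smul_eq_mul] at hcarl
  calc ∑ i ∈ T, a i ^ p * μ (Q i) = ∑ i ∈ T, μ (Q i) * a i ^ p := by simp only [mul_comm]
    _ ≤ C * ∫⁻ x, M x ^ p ∂μ := hcarl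
    _ ≤ _ := by gcongr

theorem dyadicCube_eq_pi (n : ℕ) (k : ℤ) (m : Fin n → ℤ) :
    dyadicCube n k m = Set.pi univ fun i =>
      Ico ((m i : ℝ) * (2 : ℝ) ^ (-k)) (((m i : ℝ) + 1) * (2 : ℝ) ^ (-k)) := by
  ext x
  simp [dyadicCube]

theorem measurableSet_dyadicCube (n : ℕ) (k : ℤ) (m : Fin n → ℤ) :
    MeasurableSet (dyadicCube n k m) := by
  rw [dyadicCube_eq_pi]
  exact MeasurableSet.univ_pi fun _ => measurableSet_Ico

theorem measure_dyadicCube_ne_top {n : ℕ} (μ : Measure (Fin n → ℝ)) [IsLocallyFiniteMeasure μ]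
    (k : ℤ) (m : Fin n → ℤ) : μ (dyadicCube n k m) ≠ ∞ := by
  rw [dyadicCube_eq_pi]
  refine ne_top_of_le_ne_top (isCompact_univ_pi fun i => isCompact_Icc).measure_lt_top.ne
    (measure_mono (Set.pi_mono fun i _ => Ico_subset_Icc_self))

theorem mem_dyadicCube_iff_floor {n : ℕ} {k : ℤ} {m : Fin n → ℤ} {x : Fin n → ℝ} :
    x ∈ dyadicCube n k m ↔ ∀ i, ⌊x i * (2 : ℝ) ^ k⌋ = m i := by
  have hk : (0 : ℝ) < (2 : ℝ) ^ k := by positivity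
  refine forall_congr' fun i => ?_
  rw [Int.floor_eq_iff, zpow_neg, ← div_eq_mul_inv, ← div_eq_mul_inv, div_le_iff₀ hk,
    lt_div_iff₀ hk]

theorem dyadicCube_subset_of_mem {n : ℕ} {k l : ℤ} (hkl : k ≤ l) {m m' : Fin n → ℤ}
    {x : Fin n → ℝ} (hx : x ∈ dyadicCube n k m) (hx' : x ∈ dyadicCube n l m') :
    dyadicCube n l m' ⊆ dyadicCube n k m := by
  obtain ⟨d, rfl⟩ := Int.le.dest hkl
  intro y hy
  rw [mem_dyadicCube_iff_floor] at *
  intro i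
  have hfloor : ∀ z : ℝ, ⌊z * (2 : ℝ) ^ k⌋ = ⌊z * (2 : ℝ) ^ (k + (d : ℤ))⌋ / ((2 ^ d : ℕ) : ℤ) :=
    fun z => by
      rw [← Int.floor_div_natCast]
      congr 1
      rw [zpow_add₀ (by norm_num)]
      push_cast
      rw [zpow_natCast]
      field_simp
  rw [← hx i, hfloor, hfloor, hy i, hx' i]

theorem dyadicCube_nested {n : ℕ} (i j : ℤ × (Fin n → ℤ)) :
    dyadicCube n i.1 i.2 ⊆ dyadicCube n j.1 j.2 ∨ dyadicCube n j.1 j.2 ⊆ dyadicCube n i.1 i.2 ∨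
      Disjoint (dyadicCube n i.1 i.2) (dyadicCube n j.1 j.2) := by
  by_cases hdisj : Disjoint (dyadicCube n i.1 i.2) (dyadicCube n j.1 j.2)
  · exact Or.inr (Or.inr hdisj)
  obtain ⟨x, hxi, hxj⟩ := Set.not_disjoint_iff.1 hdisj
  rcases le_total i.1 j.1 with h | h
  exacts [Or.inr (Or.inl (dyadicCube_subset_of_mem h hxi hxj)),
    Or.inl (dyadicCube_subset_of_mem h hxj hxi)]

/-- Final step of the proof (Fubini + Martingale Carleson embedding): if
`‖F_Q‖_{L^p(ν)}^p ≤ K^p (⨍_Q f dμ)^p μ(Q)` for each `Q` in a subfamily `G` of the dyadic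
lattice satisfying the Carleson condition with constant `Λ`, then
`‖(∑_{Q ∈ G} F_Q^p)^{1/p}‖_{L^p(ν)} ≤ K Λ^{1/p} p' ‖f‖_{L^p(μ)}`. -/
theorem final_step {n : ℕ} (μ ν : Measure (Fin n → ℝ)) [IsLocallyFiniteMeasure μ]
    (p : ℝ) (hp : 1 < p)
    (f : (Fin n → ℝ) → ℝ≥0∞) (hf : Measurable f) (hfLp : ∫⁻ x, f x ^ p ∂μ ≠ ∞)
    (G : Set (ℤ × (Fin n → ℤ)))
    (F : ℤ × (Fin n → ℤ) → (Fin n → ℝ) → ℝ≥0∞) (hF : ∀ i, Measurable (F i))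
    (K Λ : ℝ≥0∞)
    (hFQ : ∀ i ∈ G, (∫⁻ x, F i x ^ p ∂ν) ≤
      K ^ p * dyAvg μ f (dyadicCube n i.1 i.2) ^ p * μ (dyadicCube n i.1 i.2))
    (hCarleson : ∀ j : ℤ × (Fin n → ℤ),
      (∑' i : {i : ℤ × (Fin n → ℤ) // i ∈ G ∧ dyadicCube n i.1 i.2 ⊆ dyadicCube n j.1 j.2},
          μ (dyadicCube n (i : ℤ × (Fin n → ℤ)).1 (i : ℤ × (Fin n → ℤ)).2)) ≤
        Λ * μ (dyadicCube n j.1 j.2)) :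
    (∫⁻ x, ((∑' i : G, F (i : ℤ × (Fin n → ℤ)) x ^ p) ^ (1 / p)) ^ p ∂ν) ^ (1 / p) ≤
      K * Λ ^ (1 / p) * ENNReal.ofReal (p / (p - 1)) * (∫⁻ x, f x ^ p ∂μ) ^ (1 / p) := by
  have hp0 : 0 < p := by linarith
  set Q : ℤ × (Fin n → ℤ) → Set (Fin n → ℝ) := fun i => dyadicCube n i.1 i.2
  have hembed : ∑' i : G, dyAvg μ f (Q i) ^ p * μ (Q i) ≤
      Λ * (ENNReal.ofReal (p / (p - 1)) ^ p * ∫⁻ x, f x ^ p ∂μ) := by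
    rw [ENNReal.tsum_eq_iSup_sum]
    refine iSup_le fun T => ?_
    refine sum_dyAvg_rpow_mul_measure_le μ (fun i : G => Q i)
      (fun i => measurableSet_dyadicCube n _ _) (fun i => measure_dyadicCube_ne_top μ _ _)
      (fun i j => dyadicCube_nested _ _) T Λ (fun j B _ hB => ?_) hp hf hfLp
    refine le_trans ?_ (hCarleson j)
    let e : B → {i : ℤ × (Fin n → ℤ) // i ∈ G ∧ Q i ⊆ Q j} := fun i =>
      ⟨i.1.1, i.1.2, hB i.1 i.2⟩
    have he : Function.Injective e := fun i i' h => by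
      have hval : (e i).1 = (e i').1 := by rw [h]
      exact Subtype.ext (Subtype.ext hval)
    rw [← Finset.tsum_subtype B fun i : G => μ (Q i)]
    exact ENNReal.tsum_comp_le_tsum_of_injective he
      fun i : {i : ℤ × (Fin n → ℤ) // i ∈ G ∧ Q i ⊆ Q j} => μ (Q i)
  have hsum : ∫⁻ x, ((∑' i : G, F (i : ℤ × (Fin n → ℤ)) x ^ p) ^ (1 / p)) ^ p ∂ν ≤
      K ^ p * (Λ * (ENNReal.ofReal (p / (p - 1)) ^ p * ∫⁻ x, f x ^ p ∂μ)) := by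
    simp only [← ENNReal.rpow_mul, one_div_mul_cancel hp0.ne', ENNReal.rpow_one]
    rw [lintegral_tsum fun i : G => ((hF i).pow_const p).aemeasurable]
    refine (ENNReal.tsum_le_tsum fun i : G => hFQ i i.2).trans ?_
    simp only [mul_assoc]
    rw [ENNReal.tsum_mul_left]
    gcongr
  refine (ENNReal.rpow_le_rpow hsum (by positivity : 0 ≤ 1 / p)).trans (le_of_eq ?_)
  have hinv : 0 ≤ 1 / p := by positivity
  simp only [ENNReal.mul_rpow_of_nonneg _ _ hinv, ← ENNReal.rpow_mul, mul_one_div_cancel hp0.ne',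
    ENNReal.rpow_one, mul_assoc]
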